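/- arXiv:2205.05932 — 4 statements merged into one kernel-verified Lean document; each statement's English description precedes it below -/
import Mathlib

section
/- Let (Ω, 𝒜, P) be a probability space, p ≥ 1 an integer, and let G : Ω → ℝ^p and H : Ω → (p × p real matrices) be measurable with H(ω) symmetric for P-almost every ω. Define the quadratic log-likelihood ℓ(θ, ω) = θᵀ G(ω) + θᵀ H(ω) θ for θ ∈ ℝ^p. Assume that for every θ ∈ ℝ^p all entries of the random matrix (G + 2Hθ)(G + 2Hθ)ᵀ are P-integrable, and set M(θ) = E[(G + 2Hθ)(G + 2Hθ)ᵀ]. Let Θ₀ ⊆ ℝ^p be a convex set such that M(θ) is invertible for every θ ∈ Θ₀. Then the quadratic likelihood is identifiable on Θ₀: for all θ, θ' ∈ Θ₀, if ℓ(θ, ω) = ℓ(θ', ω) for P-almost every ω, then θ = θ'. -/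
open MeasureTheory Matrix

/-- A quadratic form with symmetric Hessian increases between two points by the gradient at their
midpoint paired with their difference. -/
theorem Matrix.IsSymm.quadratic_sub_eq_dotProduct_midpoint {n : Type*} [Fintype n]
    {A : Matrix n n ℝ} (hA : A.IsSymm) (g x y : n → ℝ) :
    (x ⬝ᵥ g + x ⬝ᵥ (A *ᵥ x)) - (y ⬝ᵥ g + y ⬝ᵥ (A *ᵥ y)) =
      (g + (2 : ℝ) • (A *ᵥ midpoint ℝ x y)) ⬝ᵥ (x - y) := by
  have hmid : (2 : ℝ) • (A *ᵥ midpoint ℝ x y) = A *ᵥ x + A *ᵥ y := by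
    rw [midpoint_eq_smul_add, mulVec_smul, smul_smul, mul_invOf_self, one_smul, mulVec_add]
  have hcomm : y ⬝ᵥ (A *ᵥ x) = x ⬝ᵥ (A *ᵥ y) := by
    rw [dotProduct_mulVec, ← mulVec_transpose, hA.eq, dotProduct_comm]
  rw [hmid, dotProduct_comm _ (x - y)]
  simp only [sub_dotProduct, dotProduct_add, hcomm]
  ring

/-- The second-moment matrix of a random vector annihilates every direction to which the vector is
almost surely orthogonal. -/
theorem integral_mul_mulVec_eq_zero {Ω n : Type*} [MeasurableSpace Ω] [Fintype n]
    {P : Measure Ω} {X : Ω → n → ℝ}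
    (hX : ∀ i j, Integrable (fun ω => X ω i * X ω j) P) {v : n → ℝ}
    (hv : ∀ᵐ ω ∂P, X ω ⬝ᵥ v = 0) :
    (Matrix.of fun i j => ∫ ω, X ω i * X ω j ∂P) *ᵥ v = 0 := by
  ext i
  simp only [mulVec, dotProduct, of_apply, Pi.zero_apply, ← integral_mul_const]
  rw [← integral_finsetSum _ fun j _ => (hX i j).mul_const (v j)]
  refine integral_eq_zero_of_ae ?_
  filter_upwards [hv] with ω hω
  simp only [mul_assoc, ← Finset.mul_sum]
  rw [← dotProduct, hω, mul_zero, Pi.zero_apply]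

/-- Identifiability of a quadratic log-likelihood `ℓ(θ,ω) = θᵀ G(ω) + θᵀ H(ω) θ`
with `H` a.s. symmetric, when the Fisher-type matrix
`M(θ) = E[(G + 2Hθ)(G + 2Hθ)ᵀ]` is invertible on a convex set `Θ₀`. -/
theorem quadratic_loglikelihood_identifiable
    {Ω : Type*} [MeasurableSpace Ω] (P : Measure Ω) [IsProbabilityMeasure P]
    (p : ℕ) (hp : 1 ≤ p)
    (G : Ω → Fin p → ℝ) (H : Ω → Matrix (Fin p) (Fin p) ℝ)
    (hG : Measurable G) (hH : ∀ i j, Measurable fun ω => H ω i j)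
    (hsym : ∀ᵐ ω ∂P, (H ω).IsSymm)
    (ℓ : (Fin p → ℝ) → Ω → ℝ)
    (hℓ : ∀ θ ω, ℓ θ ω = θ ⬝ᵥ G ω + θ ⬝ᵥ (H ω *ᵥ θ))
    (hint : ∀ (θ : Fin p → ℝ) (i j : Fin p),
      Integrable (fun ω =>
        (G ω + (2 : ℝ) • (H ω *ᵥ θ)) i * (G ω + (2 : ℝ) • (H ω *ᵥ θ)) j) P)
    (M : (Fin p → ℝ) → Matrix (Fin p) (Fin p) ℝ)
    (hM : ∀ θ i j, M θ i j =
      ∫ ω, (G ω + (2 : ℝ) • (H ω *ᵥ θ)) i * (G ω + (2 : ℝ) • (H ω *ᵥ θ)) j ∂P)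
    (Θ₀ : Set (Fin p → ℝ)) (hconv : Convex ℝ Θ₀)
    (hinv : ∀ θ ∈ Θ₀, IsUnit (M θ)) :
    ∀ θ ∈ Θ₀, ∀ θ' ∈ Θ₀, (∀ᵐ ω ∂P, ℓ θ ω = ℓ θ' ω) → θ = θ' := by
  intro θ hθ θ' hθ' heq
  set m := midpoint ℝ θ θ'
  have horth : ∀ᵐ ω ∂P, (G ω + (2 : ℝ) • (H ω *ᵥ m)) ⬝ᵥ (θ - θ') = 0 := by
    filter_upwards [hsym, heq] with ω hs he
    rw [← hs.quadratic_sub_eq_dotProduct_midpoint, ← hℓ, ← hℓ, he, sub_self]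
  have hMv : M m *ᵥ (θ - θ') = 0 := by
    rw [← integral_mul_mulVec_eq_zero (hint m) horth]
    congr 1
    ext i j
    exact hM m i j
  have hinj := mulVec_injective_iff_isUnit.mpr (hinv m (hconv.midpoint_mem hθ hθ'))
  exact sub_eq_zero.mp (hinj (hMv.trans (mulVec_zero _).symm))
end

section
/- Fix an integer d ≥ 1 and reals θ₁, θ₂, θ₃, θ₄, θ₁', θ₂', θ₃', θ₄' > 0 with θ₂ ≠ θ₄ and θ₂' ≠ θ₄'. Suppose that for every s ≥ 0, θ₁ θ₂^{−d/2} exp(−s/(4θ₂)) − θ₃ θ₄^{−d/2} exp(−s/(4θ₄)) = θ₁' θ₂'^{−d/2} exp(−s/(4θ₂')) − θ₃' θ₄'^{−d/2} exp(−s/(4θ₄')). Then θ₁ = θ₁', θ₂ = θ₂', θ₃ = θ₃' and θ₄ = θ₄'. -/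
open Real

/-- Exponentials with distinct rates are linearly independent, even when sampled at the natural
numbers. -/
theorem linearIndependent_exp_mul_natCast :
    LinearIndependent ℝ (fun (r : ℝ) (n : ℕ) => Real.exp (r * n)) := by
  have hinj : Function.Injective (fun r : ℝ => powersHom ℝ (Real.exp r)) :=
    (powersHom ℝ).injective.comp Real.exp_injective
  have h := ((linearIndependent_monoidHom (Multiplicative ℕ) ℝ).comp _ hinj).map'
    (LinearMap.funLeft ℝ ℝ (Multiplicative.ofAdd : ℕ → Multiplicative ℕ))
    (LinearMap.ker_eq_bot.2
      (LinearMap.funLeft_injective_of_surjective _ _ _ Multiplicative.ofAdd.surjective))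
  have hexp : (fun (r : ℝ) (n : ℕ) => Real.exp (r * n)) = fun (r : ℝ) (n : ℕ) =>
      powersHom ℝ (Real.exp r) (Multiplicative.ofAdd n) := by
    funext r n
    simp [mul_comm r, Real.exp_nat_mul]
  rw [hexp]
  exact h

/-- If two differences of exponentials, each with two distinct rates, agree on the natural numbers,
and all amplitudes but possibly `A'` are positive, then the rates and amplitudes coincide. -/
theorem amplitudes_rates_eq_of_exp_sub_exp_eq {A B A' B' a b a' b' : ℝ}
    (hA : 0 < A) (hB : 0 < B) (hB' : 0 < B') (hab : a ≠ b) (hab' : a' ≠ b')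
    (h : ∀ n : ℕ, A * Real.exp (a * n) - B * Real.exp (b * n)
      = A' * Real.exp (a' * n) - B' * Real.exp (b' * n)) :
    A = A' ∧ a = a' ∧ B = B' ∧ b = b' := by
  have key : Finsupp.single a A + Finsupp.single b' B'
      = Finsupp.single a' A' + Finsupp.single b B := by
    apply linearIndependent_exp_mul_natCast
    funext n
    simp only [map_add, Finsupp.linearCombination_single, Pi.add_apply, Pi.smul_apply, smul_eq_mul]
    linarith [h n]
  have coeff_eq (x : ℝ) := DFunLike.congr_fun key x
  simp only [Finsupp.add_apply, Finsupp.single_apply] at coeff_eq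
  have haa : a = a' := by
    by_contra hne
    have := coeff_eq a
    rw [if_pos rfl, if_neg (Ne.symm hne), if_neg hab.symm] at this
    split_ifs at this <;> linarith
  subst haa
  have hAA : A = A' := by simpa [hab.symm, hab'.symm] using coeff_eq a
  have hbb : b = b' := by
    by_contra hne
    have := coeff_eq b
    simp [hab, Ne.symm hne] at this
    exact hB.ne this
  subst hbb
  exact ⟨hAA, rfl, by simpa [hab] using (coeff_eq b).symm, rfl⟩

/-- Identifiability for the double layer potential model: if two combinations of
exponentials `θ₁θ₂^{−d/2} e^{−s/(4θ₂)} − θ₃θ₄^{−d/2} e^{−s/(4θ₄)}` with positive strengths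
and `θ₂ ≠ θ₄`, `θ₂' ≠ θ₄'` agree for all `s ≥ 0`, then the parameters coincide. -/
theorem doubleLayer_identifiability
    (d : ℕ) (hd : 1 ≤ d)
    (θ₁ θ₂ θ₃ θ₄ θ₁' θ₂' θ₃' θ₄' : ℝ)
    (h₁ : 0 < θ₁) (h₂ : 0 < θ₂) (h₃ : 0 < θ₃) (h₄ : 0 < θ₄)
    (h₁' : 0 < θ₁') (h₂' : 0 < θ₂') (h₃' : 0 < θ₃') (h₄' : 0 < θ₄')
    (h24 : θ₂ ≠ θ₄) (h24' : θ₂' ≠ θ₄')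
    (heq : ∀ s : ℝ, 0 ≤ s →
      θ₁ * θ₂ ^ (-(d : ℝ) / 2) * Real.exp (-s / (4 * θ₂))
          - θ₃ * θ₄ ^ (-(d : ℝ) / 2) * Real.exp (-s / (4 * θ₄))
        = θ₁' * θ₂' ^ (-(d : ℝ) / 2) * Real.exp (-s / (4 * θ₂'))
          - θ₃' * θ₄' ^ (-(d : ℝ) / 2) * Real.exp (-s / (4 * θ₄'))) :
    θ₁ = θ₁' ∧ θ₂ = θ₂' ∧ θ₃ = θ₃' ∧ θ₄ = θ₄' := by
  have rate_ne {x y : ℝ} (hxy : x ≠ y) : -(4 * x)⁻¹ ≠ -(4 * y)⁻¹ := by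
    simpa using hxy
  have amp_pos {c x : ℝ} (hc : 0 < c) (hx : 0 < x) : 0 < c * x ^ (-(d : ℝ) / 2) :=
    mul_pos hc (Real.rpow_pos_of_pos hx _)
  obtain ⟨hA, ha, hB, hb⟩ := amplitudes_rates_eq_of_exp_sub_exp_eq (amp_pos h₁ h₂) (amp_pos h₃ h₄)
    (amp_pos h₃' h₄') (rate_ne h24) (rate_ne h24') fun n => by
      have hrate (x : ℝ) : -(4 * x)⁻¹ * n = -n / (4 * x) := by ring
      simpa only [hrate] using heq n n.cast_nonneg
  obtain rfl : θ₂ = θ₂' := not_imp_not.1 rate_ne ha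
  obtain rfl : θ₄ = θ₄' := not_imp_not.1 rate_ne hb
  exact ⟨mul_right_cancel₀ (Real.rpow_pos_of_pos h₂ _).ne' hA, rfl,
    mul_right_cancel₀ (Real.rpow_pos_of_pos h₄ _).ne' hB, rfl⟩
end

section
/- Let T > 0 and let m₁, m₂ : [0, T] → ℝ be Lebesgue-integrable with m₁ square-integrable; set V(t) = m₂(t) − m₁(t)², assume V is integrable and V(t) ≥ 0 for almost every t ∈ [0, T]. Let I = [[∫₀ᵀ m₂, ∫₀ᵀ m₁, −∫₀ᵀ V], [∫₀ᵀ m₁, T, 0], [−∫₀ᵀ V, 0, ∫₀ᵀ V]]. If ∫₀ᵀ V(t)dt > 0 and m₁ is not almost-everywhere equal to a constant on [0, T], then det I > 0. -/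
open MeasureTheory intervalIntegral

/-- Strict Cauchy–Schwarz inequality against the constant function `1` on `[a, b]`. -/
theorem sq_intervalIntegral_lt_of_not_ae_const {a b : ℝ} (hab : a < b) {f : ℝ → ℝ}
    (hf : IntervalIntegrable f volume a b)
    (hfsq : IntervalIntegrable (fun t => f t ^ 2) volume a b)
    (hnc : ¬ ∃ c : ℝ, ∀ᵐ t ∂(volume.restrict (Set.Icc a b)), f t = c) :
    (∫ t in a..b, f t) ^ 2 < (b - a) * ∫ t in a..b, f t ^ 2 := by
  have hba : 0 < b - a := sub_pos.2 hab
  set c : ℝ := (∫ t in a..b, f t) / (b - a) with hc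
  have expand : (fun t => (f t - c) ^ 2) = fun t => f t ^ 2 - 2 * c * f t + c ^ 2 := by
    funext t
    ring
  have hint : IntervalIntegrable (fun t => (f t - c) ^ 2) volume a b := by
    rw [expand]
    exact (hfsq.sub (hf.const_mul (2 * c))).add intervalIntegrable_const
  have hne : ∫ t in a..b, (f t - c) ^ 2 ≠ 0 := by
    intro h
    rw [integral_eq_zero_iff_of_le_of_nonneg_ae hab.le
      (Filter.Eventually.of_forall fun t => sq_nonneg _) hint] at h
    refine hnc ⟨c, ?_⟩
    rw [← restrict_Ioc_eq_restrict_Icc]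
    filter_upwards [h] with t ht
    exact sub_eq_zero.1 (pow_eq_zero_iff two_ne_zero |>.1 ht)
  have hpos : 0 < ∫ t in a..b, (f t - c) ^ 2 :=
    lt_of_le_of_ne (integral_nonneg hab.le fun t _ => sq_nonneg _) hne.symm
  have heval : ∫ t in a..b, (f t - c) ^ 2 =
      (∫ t in a..b, f t ^ 2) - 2 * c * (∫ t in a..b, f t) + (b - a) * c ^ 2 := by
    rw [expand, integral_add (hfsq.sub (hf.const_mul (2 * c))) intervalIntegrable_const,
      integral_sub hfsq (hf.const_mul (2 * c)), intervalIntegral.integral_const_mul,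
      intervalIntegral.integral_const, smul_eq_mul]
  have hmean : ∫ t in a..b, f t = (b - a) * c := by
    rw [hc]
    field_simp
  rw [heval, hmean] at hpos
  rw [hmean]
  nlinarith [mul_pos hba hpos]

/-- Non-degeneracy of the Fisher information of the linear McKean model:
with `V = m₂ − m₁² ≥ 0` a.e. on `[0,T]`, `∫V > 0` and `m₁` not a.e. constant on `[0,T]`,
the matrix `I = [[∫m₂, ∫m₁, −∫V], [∫m₁, T, 0], [−∫V, 0, ∫V]]` has positive determinant. -/
theorem fisher_det_pos_linear_mckean
    (T : ℝ) (hT : 0 < T) (m₁ m₂ : ℝ → ℝ)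
    (hm₁ : IntervalIntegrable m₁ volume 0 T)
    (hm₂ : IntervalIntegrable m₂ volume 0 T)
    (hm₁sq : IntervalIntegrable (fun t => m₁ t ^ 2) volume 0 T)
    (V : ℝ → ℝ) (hV : ∀ t, V t = m₂ t - m₁ t ^ 2)
    (hVint : IntervalIntegrable V volume 0 T)
    (hVpos : ∀ᵐ t ∂(volume.restrict (Set.Icc (0:ℝ) T)), 0 ≤ V t)
    (I : Matrix (Fin 3) (Fin 3) ℝ)
    (hI : I = Matrix.of
      ![![∫ t in (0:ℝ)..T, m₂ t, ∫ t in (0:ℝ)..T, m₁ t, -∫ t in (0:ℝ)..T, V t],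
        ![∫ t in (0:ℝ)..T, m₁ t, T, 0],
        ![-∫ t in (0:ℝ)..T, V t, 0, ∫ t in (0:ℝ)..T, V t]])
    (hVtot : 0 < ∫ t in (0:ℝ)..T, V t)
    (hm₁nc : ¬ ∃ c : ℝ, ∀ᵐ t ∂(volume.restrict (Set.Icc (0:ℝ) T)), m₁ t = c) :
    0 < I.det := by
  have hVeq : ∫ t in (0:ℝ)..T, V t =
      (∫ t in (0:ℝ)..T, m₂ t) - ∫ t in (0:ℝ)..T, m₁ t ^ 2 := by
    rw [← integral_sub hm₂ hm₁sq]
    simp only [hV]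
  have hCS := sq_intervalIntegral_lt_of_not_ae_const hT hm₁ hm₁sq hm₁nc
  rw [sub_zero] at hCS
  have hdet : I.det = (∫ t in (0:ℝ)..T, V t) *
      (T * (∫ t in (0:ℝ)..T, m₁ t ^ 2) - (∫ t in (0:ℝ)..T, m₁ t) ^ 2) := by
    rw [hI, Matrix.det_fin_three]
    simp only [Matrix.of_apply, Matrix.cons_val]
    rw [hVeq]
    ring
  rw [hdet]
  exact mul_pos hVtot (sub_pos.2 hCS)
end

section
/- Fix d ≥ 1. Let g : ℝ^d → ℝ be nonnegative, Lebesgue-integrable with ∫ g > 0, and let f : ℝ^d → ℝ be an integrable probability density with f(y) > 0 for every y. Let F : ℝ → ℝ be injective on (0, ∞), and let θ, θ' > 0. If F(θ · (g ⋆ f)(x)) = F(θ' · (g ⋆ f)(x)) for Lebesgue-almost every x ∈ ℝ^d, where (g ⋆ f)(x) = ∫ g(x − y) f(y) dy, then θ = θ'. -/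
open MeasureTheory

/-- If `g ≥ 0` has positive integral and `f > 0` everywhere, then `∫ y, g (x - y) * f y` is positive
at every `x` where the integrand is integrable. -/
theorem integral_comp_sub_left_mul_pos {G : Type*} [MeasurableSpace G] [AddGroup G]
    [MeasurableAdd G] [MeasurableNeg G] {μ : Measure G} [μ.IsAddLeftInvariant] [μ.IsNegInvariant]
    {g f : G → ℝ} (hg : Integrable g μ) (hg0 : ∀ x, 0 ≤ g x) (hgpos : 0 < ∫ x, g x ∂μ)
    (hfpos : ∀ y, 0 < f y) {x : G} (hgf : Integrable (fun y => g (x - y) * f y) μ) :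
    0 < ∫ y, g (x - y) * f y ∂μ := by
  have hsupp : Function.support (fun y => g (x - y) * f y) =
      Function.support (fun y => g (x - y)) := by
    ext y
    simp [(hfpos y).ne']
  rw [integral_pos_iff_support_of_nonneg (fun y => mul_nonneg (hg0 _) (hfpos y).le) hgf, hsupp,
    ← integral_pos_iff_support_of_nonneg (fun y => hg0 _) (hg.comp_sub_left x),
    integral_sub_left_eq_self g μ x]
  exact hgpos

/-- Identifiability of the genuinely nonlinear model: for `g ≥ 0` integrable with positive
integral, `f` an everywhere positive integrable probability density, `F` injective on
`(0,∞)` and `θ, θ' > 0`, the a.e. equality `F(θ (g⋆f)(x)) = F(θ' (g⋆f)(x))` forces `θ = θ'`. -/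
theorem nonlinear_model_identifiability
    (d : ℕ) (hd : 1 ≤ d)
    (g f : (Fin d → ℝ) → ℝ) (F : ℝ → ℝ)
    (hg : Integrable g) (hg0 : ∀ x, 0 ≤ g x) (hgpos : 0 < ∫ x, g x)
    (hf : Integrable f) (hfpos : ∀ y, 0 < f y) (hf1 : ∫ y, f y = 1)
    (hF : Set.InjOn F (Set.Ioi 0))
    (θ θ' : ℝ) (hθ : 0 < θ) (hθ' : 0 < θ')
    (heq : ∀ᵐ x ∂(volume : Measure (Fin d → ℝ)),
      F (θ * ∫ y, g (x - y) * f y) = F (θ' * ∫ y, g (x - y) * f y)) :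
    θ = θ' := by
  have hint : ∀ᵐ x ∂(volume : Measure (Fin d → ℝ)), Integrable (fun y => g (x - y) * f y) := by
    filter_upwards [hf.ae_convolution_exists (ContinuousLinearMap.mul ℝ ℝ) hg] with x hx
    simpa [ConvolutionExistsAt, mul_comm] using hx
  obtain ⟨x, hx, hxF⟩ := (hint.and heq).exists
  have hpos := integral_comp_sub_left_mul_pos hg hg0 hgpos hfpos hx
  exact mul_right_cancel₀ hpos.ne' (hF (mul_pos hθ hpos) (mul_pos hθ' hpos) hxF)
end
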